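/- For every choice of an integer n ≥ 2 and positive real parameters M, δ, C, C₀, τ and k, there exist positive real numbers ε, γ₁, γ₂ and a₀ with γ₁ > γ₂, 1 − (ε/2)C > 0 and γ₁[k²(2M²/δ + (n−1)²/(2ε)) + M] − k ≤ 0, such that for every real a with 0 ≤ a < a₀ there exists ξ > 0 satisfying: (a+ξ)/2 < γ₁ − γ₂; a(1/2 + (3/2)γ₁) − ξ/2 ≤ γ₂ e^{−τ}; and a(M² + (1/2)(n−1)²C₀) < 1 − (ε/2)C. -/

import Mathlib

/-- Algebraic core of Proposition 3.4: for every integer `n ≥ 2` and positive parameters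
`M, δ, C, C₀, τ, k`, there exist positive `ε, γ₁, γ₂, a₀` with `γ₁ > γ₂`,
`1 - (ε/2)C > 0` and `γ₁[k²(2M²/δ + (n-1)²/(2ε)) + M] - k ≤ 0`, such that for every
`0 ≤ a < a₀` there is `ξ > 0` satisfying the three remaining stability constraints. -/
theorem delayed_wave_constants_exist
    (n : ℕ) (hn : 2 ≤ n) (M δ C C₀ τ k : ℝ)
    (hM : 0 < M) (hδ : 0 < δ) (hC : 0 < C) (hC₀ : 0 < C₀) (hτ : 0 < τ) (hk : 0 < k) :
    ∃ ε γ₁ γ₂ a₀ : ℝ, 0 < ε ∧ 0 < γ₁ ∧ 0 < γ₂ ∧ 0 < a₀ ∧ γ₂ < γ₁ ∧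
      0 < 1 - ε / 2 * C ∧
      γ₁ * (k ^ 2 * (2 * M ^ 2 / δ + ((n : ℝ) - 1) ^ 2 / (2 * ε)) + M) - k ≤ 0 ∧
      ∀ a : ℝ, 0 ≤ a → a < a₀ → ∃ ξ : ℝ, 0 < ξ ∧
        (a + ξ) / 2 < γ₁ - γ₂ ∧
        a * (1 / 2 + 3 / 2 * γ₁) - ξ / 2 ≤ γ₂ * Real.exp (-τ) ∧
        a * (M ^ 2 + 1 / 2 * ((n : ℝ) - 1) ^ 2 * C₀) < 1 - ε / 2 * C := by
  obtain ⟨D, hD⟩ : ∃ D, D = k ^ 2 * (2 * M ^ 2 / δ + ((n : ℝ) - 1) ^ 2 / (2 * (1 / C))) + M :=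
    ⟨_, rfl⟩
  have hDpos : 0 < D := by rw [hD]; positivity
  obtain ⟨B, hB⟩ : ∃ B, B = M ^ 2 + 1 / 2 * ((n : ℝ) - 1) ^ 2 * C₀ := ⟨_, rfl⟩
  have hBpos : 0 < B := by rw [hB]; positivity
  obtain ⟨g, hg⟩ : ∃ g, g = k / D := ⟨_, rfl⟩
  have hgpos : 0 < g := by rw [hg]; positivity
  have hgD : g * D = k := by rw [hg]; field_simp
  have hεC : 1 / C / 2 * C = 1 / 2 := by field_simp
  refine ⟨1 / C, g, g / 2, min (g / 2) (min (g / (2 + 6 * g)) (1 / (2 * B))), by positivity,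
    hgpos, by positivity, by positivity, by linarith, by rw [hεC]; norm_num, ?_, ?_⟩
  · rw [← hD, hgD]; simp
  · intro a ha0 ha
    rw [lt_min_iff, lt_min_iff] at ha
    obtain ⟨h1, h2, h3⟩ := ha
    rw [lt_div_iff₀ (by positivity)] at h2 h3
    refine ⟨g / 2, by positivity, by linarith, ?_, ?_⟩
    · have : 0 < g / 2 * Real.exp (-τ) := by positivity
      linarith
    · rw [hεC, ← hB]; linarith
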